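/- arXiv:1509.01447 — 4 statements merged into one kernel-verified Lean document; each statement's English description precedes it below -/
import Mathlib

section
/- Let H be a real Hilbert space, (e_k)_{k ∈ ℕ} an orthonormal family in H, λ : ℕ → ℝ nonnegative, and u : ℕ → ℝ square-summable. Then the map v(y) := Σ_k e^{−y√λ_k} u_k e_k from (0,∞) to H is infinitely differentiable, and for every y > 0 its derivative is v'(y) = −Σ_k √λ_k e^{−y√λ_k} u_k e_k (this series converging in H). -/
theorem hes_aux {H : Type*} [NormedAddCommGroup H]
    [InnerProductSpace ℝ H] [CompleteSpace H]
    (e : ℕ → H) (he : Orthonormal ℝ e)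
    (u : ℕ → ℝ) (hu : Summable fun k => (u k) ^ 2) (c : ℕ → ℝ) (C : ℝ) (hC : 0 ≤ C)
    (hc : ∀ k, |c k| ≤ C * |u k|) :
    Summable (fun k => c k • e k) ∧
      ‖∑' k, c k • e k‖ ≤ C * Real.sqrt (∑' k, (u k) ^ 2) := by
  have hsq : ∀ k, (c k) ^ 2 ≤ C ^ 2 * (u k) ^ 2 := by
    intro k
    rw [← mul_pow]
    apply sq_le_sq.2
    rw [abs_mul, abs_of_nonneg hC]
    exact hc k
  have hs : Summable (fun k => (c k) ^ 2) :=
    Summable.of_nonneg_of_le (fun k => sq_nonneg _) hsq (hu.mul_left _)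
  have hsum : Summable (fun k => c k • e k) := by
    have := (he.orthogonalFamily.summable_iff_norm_sq_summable (fun k => c k)).2
      (by simpa using hs)
    simpa using this
  refine ⟨hsum, ?_⟩
  refine le_of_tendsto hsum.hasSum.norm (Filter.Eventually.of_forall fun s => ?_)
  have h1 : ‖∑ k ∈ s, c k • e k‖ ^ 2 = ∑ k ∈ s, (c k) ^ 2 := by
    rw [← real_inner_self_eq_norm_sq, he.inner_sum]
    simp [sq]
  have h2 : ‖∑ k ∈ s, c k • e k‖ ^ 2 ≤ C ^ 2 * ∑' k, (u k) ^ 2 := by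
    rw [h1]
    calc ∑ k ∈ s, (c k) ^ 2 ≤ ∑ k ∈ s, C ^ 2 * (u k) ^ 2 := Finset.sum_le_sum fun k _ => hsq k
      _ = C ^ 2 * ∑ k ∈ s, (u k) ^ 2 := by rw [Finset.mul_sum]
      _ ≤ _ := by
        gcongr
        exact hu.sum_le_tsum s (fun k _ => sq_nonneg _)
  have h3 := Real.le_sqrt_of_sq_le h2
  rwa [Real.sqrt_mul (sq_nonneg _), Real.sqrt_sq hC] at h3

theorem hes_bound (s y : ℝ) (hs : 0 ≤ s) (hy : 0 < y) (m : ℕ) :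
    s ^ m * Real.exp (-y * s) ≤ m.factorial / y ^ m := by
  have h := Real.pow_div_factorial_le_exp (y * s) (by positivity) m
  rw [div_le_iff₀ (by positivity)] at h
  rw [le_div_iff₀ (by positivity), neg_mul, Real.exp_neg]
  have := Real.exp_pos (y * s)
  calc s ^ m * (Real.exp (y * s))⁻¹ * y ^ m = (y * s) ^ m * (Real.exp (y * s))⁻¹ := by ring
    _ ≤ (Real.exp (y * s) * m.factorial) * (Real.exp (y * s))⁻¹ := by gcongr
    _ = _ := by field_simp

theorem hes_taylor (x : ℝ) : |Real.exp x - 1 - x| ≤ x ^ 2 * Real.exp |x| := by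
  have h := Complex.norm_exp_sub_sum_le_norm_mul_exp (x : ℂ) 2
  have h2 : Complex.exp (x : ℂ) - ∑ m ∈ Finset.range 2, (x : ℂ) ^ m / (m.factorial : ℂ)
      = ((Real.exp x - 1 - x : ℝ) : ℂ) := by
    simp [Finset.sum_range_succ]
    ring
  rw [h2, Complex.norm_real, Complex.norm_real] at h
  simpa using h

theorem hes_scalar (s y h : ℝ) (hs : 0 ≤ s) (hy : 0 < y) (hh : |h| ≤ y / 2) (n : ℕ) :
    |s ^ n * Real.exp (-(y + h) * s) - s ^ n * Real.exp (-y * s)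
      + h * (s ^ (n + 1) * Real.exp (-y * s))|
      ≤ ((n + 2).factorial / (y / 2) ^ (n + 2)) * h ^ 2 := by
  have e1 : s ^ n * Real.exp (-(y + h) * s) - s ^ n * Real.exp (-y * s)
      + h * (s ^ (n + 1) * Real.exp (-y * s))
      = (s ^ n * Real.exp (-y * s)) * (Real.exp (-(h * s)) - 1 - -(h * s)) := by
    have : -(y + h) * s = -y * s + -(h * s) := by ring
    rw [this, Real.exp_add]
    ring
  rw [e1, abs_mul, abs_of_nonneg (by positivity)]
  have hT := hes_taylor (-(h * s))
  have hA : |(-(h * s))| ≤ y / 2 * s := by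
    rw [abs_neg, abs_mul, abs_of_nonneg hs]
    gcongr
  have hE : Real.exp (-y * s) * Real.exp (y / 2 * s) = Real.exp (-(y / 2) * s) := by
    rw [← Real.exp_add]; congr 1; ring
  calc (s ^ n * Real.exp (-y * s)) * |Real.exp (-(h * s)) - 1 - -(h * s)|
      ≤ (s ^ n * Real.exp (-y * s)) * ((-(h * s)) ^ 2 * Real.exp (y / 2 * s)) := by
        gcongr
        exact hT.trans (by gcongr)
    _ = (s ^ (n + 2) * (Real.exp (-y * s) * Real.exp (y / 2 * s))) * h ^ 2 := by ring
    _ ≤ _ := by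
        rw [hE]
        gcongr
        exact hes_bound s (y / 2) hs (by positivity) (n + 2)

theorem hes_deriv {H : Type*} [NormedAddCommGroup H]
    [InnerProductSpace ℝ H] [CompleteSpace H]
    (e : ℕ → H) (he : Orthonormal ℝ e) (s : ℕ → ℝ) (hs : ∀ k, 0 ≤ s k)
    (u : ℕ → ℝ) (hu : Summable fun k => (u k) ^ 2) (n : ℕ) (y : ℝ) (hy : 0 < y) :
    (Summable fun k => (s k ^ n * Real.exp (-y * s k) * u k) • e k) ∧
    HasDerivAt (fun y : ℝ => ∑' k, (s k ^ n * Real.exp (-y * s k) * u k) • e k)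
      (-∑' k, (s k ^ (n + 1) * Real.exp (-y * s k) * u k) • e k) y := by
  have hS : ∀ (n : ℕ) (y : ℝ), 0 < y →
      Summable fun k => (s k ^ n * Real.exp (-y * s k) * u k) • e k := by
    intro n y hy
    refine (hes_aux e he u hu _ (n.factorial / y ^ n) (by positivity) fun k => ?_).1
    have := hs k
    rw [abs_mul, abs_of_nonneg (by positivity)]
    gcongr
    exact hes_bound _ _ (hs k) hy n
  refine ⟨hS n y hy, ?_⟩
  rw [hasDerivAt_iff_isLittleO_nhds_zero]
  set D : ℝ := (n + 2).factorial / (y / 2) ^ (n + 2) with hD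
  have hD0 : 0 ≤ D := by positivity
  refine Asymptotics.IsBigO.trans_isLittleO (g := fun h : ℝ => h ^ 2) ?_ ?_
  · refine Asymptotics.IsBigO.of_bound (D * Real.sqrt (∑' k, (u k) ^ 2)) ?_
    have hb : ∀ᶠ h : ℝ in nhds 0, |h| ≤ y / 2 := by
      have := Metric.closedBall_mem_nhds (0 : ℝ) (half_pos hy)
      filter_upwards [this] with h hh
      simpa using hh
    filter_upwards [hb] with h hh
    have hyh : 0 < y + h := by have := (abs_le.1 hh).1; linarith
    have key := (hes_aux e he u hu (fun k => (s k ^ n * Real.exp (-(y + h) * s k)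
      - s k ^ n * Real.exp (-y * s k) + h * (s k ^ (n + 1) * Real.exp (-y * s k))) * u k)
      (D * h ^ 2) (by positivity) (fun k => by
        rw [abs_mul]
        gcongr
        exact hes_scalar (s k) y h (hs k) hy hh n)).2
    have hsum := (((hS n (y + h) hyh).hasSum.sub (hS n y hy).hasSum).add
      ((hS (n + 1) y hy).hasSum.const_smul h)).tsum_eq
    have e2 : (∑' k, (s k ^ n * Real.exp (-(y + h) * s k) * u k) • e k)
        - (∑' k, (s k ^ n * Real.exp (-y * s k) * u k) • e k)
        - h • (-∑' k, (s k ^ (n + 1) * Real.exp (-y * s k) * u k) • e k)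
        = ∑' k, ((s k ^ n * Real.exp (-(y + h) * s k)
      - s k ^ n * Real.exp (-y * s k) + h * (s k ^ (n + 1) * Real.exp (-y * s k))) * u k) • e k := by
      rw [smul_neg, sub_neg_eq_add, ← hsum]
      refine tsum_congr fun k => ?_
      module
    rw [e2, Real.norm_of_nonneg (sq_nonneg h)]
    refine key.trans (le_of_eq ?_)
    ring
  · simpa using Asymptotics.isLittleO_pow_id (𝕜 := ℝ) (n := 2) (by norm_num)

theorem hes_contDiff {H : Type*} [NormedAddCommGroup H]
    [InnerProductSpace ℝ H] [CompleteSpace H]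
    (e : ℕ → H) (he : Orthonormal ℝ e) (s : ℕ → ℝ) (hs : ∀ k, 0 ≤ s k)
    (u : ℕ → ℝ) (hu : Summable fun k => (u k) ^ 2) (m : ℕ) : ∀ n : ℕ,
    ContDiffOn ℝ m (fun y : ℝ => ∑' k, (s k ^ n * Real.exp (-y * s k) * u k) • e k)
      (Set.Ioi 0) := by
  induction m with
  | zero =>
    intro n
    refine contDiffOn_zero.2 fun y hy => ?_
    exact (hes_deriv e he s hs u hu n y hy).2.continuousAt.continuousWithinAt
  | succ m ih =>
    intro n
    push_cast
    rw [contDiffOn_succ_iff_deriv_of_isOpen isOpen_Ioi]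
    refine ⟨fun y hy =>
      (hes_deriv e he s hs u hu n y hy).2.differentiableAt.differentiableWithinAt, by simp, ?_⟩
    exact (ih (n + 1)).neg.congr fun y hy => (hes_deriv e he s hs u hu n y hy).2.deriv

/-- Smoothness of the harmonic extension `y ↦ Σ_k e^{−y√λ_k} u_k e_k` on `(0,∞)`, stated for an
orthonormal family `(e_k)` in a real Hilbert space, with `λ_k ≥ 0` and `u` square-summable:
the map is `C^∞` on `(0,∞)` and for every `y > 0` its derivative is
`−Σ_k √λ_k e^{−y√λ_k} u_k e_k`, this series converging in `H`. -/
theorem harmonic_extension_smooth {H : Type*} [NormedAddCommGroup H]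
    [InnerProductSpace ℝ H] [CompleteSpace H]
    (e : ℕ → H) (he : Orthonormal ℝ e) (lam : ℕ → ℝ) (hlam : ∀ k, 0 ≤ lam k)
    (u : ℕ → ℝ) (hu : Summable fun k => (u k) ^ 2) :
    ContDiffOn ℝ (⊤ : ℕ∞) (fun y : ℝ => ∑' k, (Real.exp (-y * Real.sqrt (lam k)) * u k) • e k)
      (Set.Ioi 0) ∧
    ∀ y : ℝ, 0 < y →
      (Summable fun k =>
        (Real.sqrt (lam k) * Real.exp (-y * Real.sqrt (lam k)) * u k) • e k) ∧
      HasDerivAt (fun y : ℝ => ∑' k, (Real.exp (-y * Real.sqrt (lam k)) * u k) • e k)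
        (-∑' k, (Real.sqrt (lam k) * Real.exp (-y * Real.sqrt (lam k)) * u k) • e k) y := by
  constructor
  · refine contDiffOn_infty.2 fun m => ?_
    simpa using hes_contDiff e he (fun k => Real.sqrt (lam k)) (fun k => Real.sqrt_nonneg _) u hu m 0
  · intro y hy
    have h0 := hes_deriv e he (fun k => Real.sqrt (lam k)) (fun k => Real.sqrt_nonneg _) u hu 0 y hy
    have h1 := hes_deriv e he (fun k => Real.sqrt (lam k)) (fun k => Real.sqrt_nonneg _) u hu 1 y hy
    simp only [pow_zero, one_mul, zero_add, pow_one] at h0 h1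
    exact ⟨h1.1, h0.2⟩
end

section
/- Let λ > 0 and R > 0, set a := √λ, and let w(y) = sinh(a(R−y))/sinh(aR) for y ∈ [0,R]. Then the difference d(y) := e^{−ay} − w(y) equals e^{−aR} sinh(ay)/sinh(aR) on [0,R], and ∫_0^R (d'(y)² + λ d(y)²) dy + ∫_R^∞ 2λ e^{−2ay} dy = √λ · e^{−2√λ R} · (1 + coth(√λ R)). In particular this quantity tends to 0 as R → ∞. -/
open MeasureTheory Filter

/-- Per-mode Dirichlet energy of the difference between the harmonic extension profile `e^{−ay}`
and the truncated profile `w(y) = sinh(a(R−y))/sinh(aR)`, `a = √λ`: the difference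
`d = e^{−ay} − w` equals `e^{−aR} sinh(ay)/sinh(aR)` on `[0,R]`, the total energy
`∫_0^R ((d')² + λ d²) + ∫_R^∞ 2λ e^{−2ay}` equals `√λ e^{−2√λR}(1 + coth(√λ R))`, and this
quantity tends to `0` as `R → ∞`. -/
theorem truncated_mode_difference_energy (lam R : ℝ) (hlam : 0 < lam) (hR : 0 < R)
    (a : ℝ) (ha : a = Real.sqrt lam)
    (w : ℝ → ℝ) (hw : ∀ y, w y = Real.sinh (a * (R - y)) / Real.sinh (a * R))
    (d : ℝ → ℝ) (hd : ∀ y, d y = Real.exp (-(a * y)) - w y) :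
    (∀ y ∈ Set.Icc (0:ℝ) R,
      d y = Real.exp (-(a * R)) * Real.sinh (a * y) / Real.sinh (a * R)) ∧
    ((∫ y in (0:ℝ)..R, ((deriv d y) ^ 2 + lam * (d y) ^ 2))
        + ∫ y in Set.Ioi R, 2 * lam * Real.exp (-(2 * a * y))
      = Real.sqrt lam * Real.exp (-(2 * Real.sqrt lam * R)) *
          (1 + Real.cosh (Real.sqrt lam * R) / Real.sinh (Real.sqrt lam * R))) ∧
    Tendsto (fun R' : ℝ => Real.sqrt lam * Real.exp (-(2 * Real.sqrt lam * R')) *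
        (1 + Real.cosh (Real.sqrt lam * R') / Real.sinh (Real.sqrt lam * R')))
      atTop (nhds 0) := by
  have hapos : 0 < a := by rw [ha]; exact Real.sqrt_pos.mpr hlam
  have hsq : lam = a ^ 2 := by rw [ha, Real.sq_sqrt hlam.le]
  have hS : 0 < Real.sinh (a * R) := Real.sinh_pos_iff.mpr (mul_pos hapos hR)
  rw [← ha]
  have hdy : ∀ y, d y = Real.exp (-(a * R)) * Real.sinh (a * y) / Real.sinh (a * R) := by
    intro y
    rw [hd, hw, eq_div_iff hS.ne', sub_mul, div_mul_cancel₀ _ hS.ne', mul_sub, Real.sinh_sub]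
    rw [← Real.cosh_sub_sinh, ← Real.cosh_sub_sinh]
    ring
  have hE : Real.exp (-(2 * a * R)) = Real.exp (-(a * R)) ^ 2 := by
    rw [← Real.exp_nat_mul]; congr 1; push_cast; ring
  refine ⟨fun y _ => hdy y, ?_, ?_⟩
  · have hs : ∀ y : ℝ, HasDerivAt (fun y => Real.sinh (a * y)) (Real.cosh (a * y) * a) y := by
      intro y
      have := ((hasDerivAt_id y).const_mul a).sinh
      simpa using this
    have hc : ∀ y : ℝ, HasDerivAt (fun y => Real.cosh (a * y)) (Real.sinh (a * y) * a) y := by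
      intro y
      have := ((hasDerivAt_id y).const_mul a).cosh
      simpa using this
    have hder : ∀ y, deriv d y
        = Real.exp (-(a * R)) * (Real.cosh (a * y) * a) / Real.sinh (a * R) := by
      intro y
      rw [funext hdy]
      exact (((hs y).const_mul _).div_const _).deriv
    have h1 : (∫ y in (0:ℝ)..R, ((deriv d y) ^ 2 + lam * (d y) ^ 2))
        = a * Real.exp (-(a * R)) ^ 2 * (Real.cosh (a * R) / Real.sinh (a * R)) := by
      simp_rw [hder, hdy]
      rw [intervalIntegral.integral_eq_sub_of_hasDerivAt
        (f := fun y => a * Real.exp (-(a * R)) ^ 2 / Real.sinh (a * R) ^ 2 *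
          (Real.sinh (a * y) * Real.cosh (a * y)))]
      · simp only [mul_zero, Real.sinh_zero, zero_mul, sub_zero]
        field_simp
      · intro y _
        refine (((hs y).mul (hc y)).const_mul
          (a * Real.exp (-(a * R)) ^ 2 / Real.sinh (a * R) ^ 2)).congr_deriv ?_
        rw [hsq]
        field_simp
      · apply Continuous.intervalIntegrable
        fun_prop
    have h2 : (∫ y in Set.Ioi R, 2 * lam * Real.exp (-(2 * a * y)))
        = a * Real.exp (-(a * R)) ^ 2 := by
      have := integral_exp_mul_Ioi (a := -(2 * a)) (by linarith) R
      rw [integral_const_mul]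
      simp only [neg_mul] at this
      rw [this, hE, hsq]
      field_simp
    rw [h1, h2, hE]
    ring
  · have hx : Tendsto (fun x : ℝ => a * x) atTop atTop := tendsto_id.const_mul_atTop hapos
    have hsinh : Tendsto Real.sinh atTop atTop := by
      refine tendsto_atTop_mono' _ ?_ tendsto_id
      filter_upwards [eventually_ge_atTop (0:ℝ)] with x h
      exact Real.self_le_sinh_iff.mpr h
    have key : Tendsto (fun x : ℝ => a * (Real.exp (-x) * (Real.sinh x)⁻¹)) atTop (nhds 0) := by
      have := (Real.tendsto_exp_neg_atTop_nhds_zero.mul hsinh.inv_tendsto_atTop).const_mul a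
      simpa using this
    refine (key.comp hx).congr' ?_
    filter_upwards [eventually_gt_atTop (0:ℝ)] with x h
    have h3 : 0 < Real.sinh (a * x) := Real.sinh_pos_iff.mpr (mul_pos hapos h)
    have h4 : Real.exp (-(a * x)) = Real.exp (-(2 * a * x)) * Real.exp (a * x) := by
      rw [← Real.exp_add]; congr 1; ring
    simp only [Function.comp]
    rw [h4, ← Real.sinh_add_cosh (a * x)]
    field_simp
end

section
/- Let λ₁ > 0, let λ : ℕ → ℝ satisfy λ_k ≥ λ₁ for all k, and let u : ℕ → ℝ satisfy Σ_k √λ_k u_k² < ∞. Then for every R > 0, Σ_k √λ_k e^{−2R√λ_k}(1 + coth(√λ_k R)) u_k² ≤ (1 + coth(√λ₁ R)) e^{−2R√λ₁} Σ_k √λ_k u_k², and the left-hand side tends to 0 as R → ∞. -/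
open Filter

lemma coth_anti_aux {x y : ℝ} (hx : 0 < x) (hxy : x ≤ y) :
    Real.cosh y / Real.sinh y ≤ Real.cosh x / Real.sinh x := by
  have h1 : 0 < Real.sinh x := Real.sinh_pos_iff.2 hx
  have h2 : 0 < Real.sinh y := Real.sinh_pos_iff.2 (hx.trans_le hxy)
  rw [div_le_div_iff₀ h2 h1]
  have h3 : 0 ≤ Real.sinh (y - x) := Real.sinh_nonneg_iff.2 (by linarith)
  rw [Real.sinh_sub] at h3
  linarith

lemma coth_nonneg_aux {x : ℝ} (hx : 0 < x) : 0 ≤ Real.cosh x / Real.sinh x :=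
  div_nonneg (Real.cosh_pos x).le (Real.sinh_pos_iff.2 hx).le

/-- Series form of the convergence of truncated harmonic extensions: if `λ_k ≥ λ₁ > 0` and
`Σ_k √λ_k u_k² < ∞`, then for every `R > 0`,
`Σ_k √λ_k e^{−2R√λ_k}(1 + coth(√λ_k R)) u_k² ≤ (1 + coth(√λ₁ R)) e^{−2R√λ₁} Σ_k √λ_k u_k²`,
and the left-hand side tends to `0` as `R → ∞`. -/
theorem truncated_extension_convergence (lam1 : ℝ) (hlam1 : 0 < lam1)
    (lam : ℕ → ℝ) (hlam : ∀ k, lam1 ≤ lam k)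
    (u : ℕ → ℝ) (hu : Summable fun k => Real.sqrt (lam k) * (u k) ^ 2) :
    (∀ R : ℝ, 0 < R →
      ∑' k, Real.sqrt (lam k) * Real.exp (-2 * R * Real.sqrt (lam k)) *
          (1 + Real.cosh (Real.sqrt (lam k) * R) / Real.sinh (Real.sqrt (lam k) * R)) * (u k) ^ 2
        ≤ (1 + Real.cosh (Real.sqrt lam1 * R) / Real.sinh (Real.sqrt lam1 * R)) *
            Real.exp (-2 * R * Real.sqrt lam1) * ∑' k, Real.sqrt (lam k) * (u k) ^ 2) ∧
    Tendsto (fun R : ℝ =>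
        ∑' k, Real.sqrt (lam k) * Real.exp (-2 * R * Real.sqrt (lam k)) *
          (1 + Real.cosh (Real.sqrt (lam k) * R) / Real.sinh (Real.sqrt (lam k) * R)) * (u k) ^ 2)
      atTop (nhds 0) := by
  have ha : 0 < Real.sqrt lam1 := Real.sqrt_pos.2 hlam1
  have hk : ∀ k, Real.sqrt lam1 ≤ Real.sqrt (lam k) := fun k => Real.sqrt_le_sqrt (hlam k)
  have hnn : ∀ R : ℝ, 0 < R → ∀ k, 0 ≤ Real.sqrt (lam k) * Real.exp (-2 * R * Real.sqrt (lam k)) *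
      (1 + Real.cosh (Real.sqrt (lam k) * R) / Real.sinh (Real.sqrt (lam k) * R)) * (u k) ^ 2 := by
    intro R hR k
    have := coth_nonneg_aux (mul_pos (ha.trans_le (hk k)) hR)
    positivity
  have hle : ∀ R : ℝ, 0 < R → ∀ k, Real.sqrt (lam k) * Real.exp (-2 * R * Real.sqrt (lam k)) *
      (1 + Real.cosh (Real.sqrt (lam k) * R) / Real.sinh (Real.sqrt (lam k) * R)) * (u k) ^ 2 ≤
      (1 + Real.cosh (Real.sqrt lam1 * R) / Real.sinh (Real.sqrt lam1 * R)) *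
            Real.exp (-2 * R * Real.sqrt lam1) * (Real.sqrt (lam k) * (u k) ^ 2) := by
    intro R hR k
    have h0 := coth_nonneg_aux (mul_pos (ha.trans_le (hk k)) hR)
    have h1 := coth_anti_aux (mul_pos ha hR) (mul_le_mul_of_nonneg_right (hk k) hR.le)
    have h2 : Real.exp (-2 * R * Real.sqrt (lam k)) ≤ Real.exp (-2 * R * Real.sqrt lam1) :=
      Real.exp_le_exp.2 (by nlinarith [hk k])
    have h3 := mul_le_mul (add_le_add_right h1 1) h2 (Real.exp_pos _).le (by linarith)
    have h4 := mul_le_mul_of_nonneg_right h3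
      (by positivity : 0 ≤ Real.sqrt (lam k) * (u k) ^ 2)
    linarith
  have main : ∀ R : ℝ, 0 < R →
      ∑' k, Real.sqrt (lam k) * Real.exp (-2 * R * Real.sqrt (lam k)) *
          (1 + Real.cosh (Real.sqrt (lam k) * R) / Real.sinh (Real.sqrt (lam k) * R)) * (u k) ^ 2
        ≤ (1 + Real.cosh (Real.sqrt lam1 * R) / Real.sinh (Real.sqrt lam1 * R)) *
            Real.exp (-2 * R * Real.sqrt lam1) * ∑' k, Real.sqrt (lam k) * (u k) ^ 2 := by
    intro R hR
    rw [← tsum_mul_left]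
    exact Summable.tsum_le_tsum (hle R hR)
      (Summable.of_nonneg_of_le (hnn R hR) (hle R hR) (hu.mul_left _)) (hu.mul_left _)
  refine ⟨main, ?_⟩
  have hS : 0 ≤ ∑' k, Real.sqrt (lam k) * (u k) ^ 2 := tsum_nonneg fun k => by positivity
  have hlim : Tendsto (fun R : ℝ =>
      (1 + Real.cosh (Real.sqrt lam1) / Real.sinh (Real.sqrt lam1)) *
      Real.exp (-2 * R * Real.sqrt lam1) * ∑' k, Real.sqrt (lam k) * (u k) ^ 2)
      atTop (nhds 0) := by
    have he : Tendsto (fun R : ℝ => Real.exp (-2 * R * Real.sqrt lam1)) atTop (nhds 0) := by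
      have h := Real.tendsto_exp_neg_atTop_nhds_zero.comp
        (tendsto_id.const_mul_atTop (by positivity : 0 < 2 * Real.sqrt lam1))
      refine h.congr fun R => ?_
      simp only [Function.comp, id]
      congr 1
      ring
    simpa using (he.const_mul
      (1 + Real.cosh (Real.sqrt lam1) / Real.sinh (Real.sqrt lam1))).mul_const
      (∑' k, Real.sqrt (lam k) * (u k) ^ 2)
  refine tendsto_of_tendsto_of_tendsto_of_le_of_le' tendsto_const_nhds hlim ?_ ?_
  · filter_upwards [eventually_gt_atTop 0] with R hR
    exact tsum_nonneg (hnn R hR)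
  · filter_upwards [eventually_ge_atTop 1] with R hR
    refine (main R (by linarith)).trans ?_
    have h1 := coth_anti_aux ha (le_mul_of_one_le_right ha.le hR)
    gcongr
end

section
/- Let λ > 0. For R > 0 define W_R : [0,∞) → ℝ by W_R(y) = sinh(√λ(R−y))/sinh(√λ R) for 0 ≤ y ≤ R and W_R(y) = 0 for y > R. If (R_n) is a sequence of positive reals with R_n → ∞ and (α_n) is a sequence of reals with α_n → α, then ∫_0^∞ |α_n W_{R_n}(y) − α e^{−√λ y}|² dy → 0 as n → ∞. -/
open MeasureTheory Filter

lemma mode_formula (s R y : ℝ) (hs : 0 < s) (hR : 0 < R) :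
    Real.sinh (s * (R - y)) / Real.sinh (s * R) =
      Real.exp (-(s * y)) - Real.exp (-(s * R)) * Real.sinh (s * y) * (Real.sinh (s * R))⁻¹ := by
  have hp : 0 < Real.sinh (s * R) := Real.sinh_pos_iff.mpr (mul_pos hs hR)
  have key : Real.sinh (s * (R - y)) =
      Real.exp (-(s * y)) * Real.sinh (s * R) - Real.exp (-(s * R)) * Real.sinh (s * y) := by
    rw [mul_sub, Real.sinh_sub, ← Real.cosh_sub_sinh, ← Real.cosh_sub_sinh]
    ring
  rw [key]
  field_simp

/-- Per-mode continuous convergence (Lemma 2.12): for `λ > 0`, with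
`W_R(y) = sinh(√λ(R−y))/sinh(√λ R)` for `0 ≤ y ≤ R` and `W_R(y) = 0` for `y > R`,
if `R_n → ∞` (with `R_n > 0`) and `α_n → α`, then
`∫_0^∞ |α_n W_{R_n}(y) − α e^{−√λ y}|² dy → 0`. -/
theorem truncated_mode_continuous_convergence (lam : ℝ) (hlam : 0 < lam)
    (W : ℝ → ℝ → ℝ)
    (hW : ∀ R y : ℝ, W R y =
      if y ≤ R then Real.sinh (Real.sqrt lam * (R - y)) / Real.sinh (Real.sqrt lam * R) else 0)
    (R : ℕ → ℝ) (hRpos : ∀ n, 0 < R n) (hR : Tendsto R atTop atTop)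
    (α : ℕ → ℝ) (a : ℝ) (hα : Tendsto α atTop (nhds a)) :
    Tendsto (fun n =>
        ∫ y in Set.Ioi (0:ℝ), |α n * W (R n) y - a * Real.exp (-(Real.sqrt lam * y))| ^ 2)
      atTop (nhds 0) := by
  set s := Real.sqrt lam with hsdef
  have hs : 0 < s := Real.sqrt_pos.mpr hlam
  obtain ⟨C, hC⟩ := hα.abs.bddAbove_range
  have hC' : ∀ n, |α n| ≤ C := fun n => hC ⟨n, rfl⟩
  have hC0 : 0 ≤ C := (abs_nonneg _).trans (hC' 0)
  have hWb : ∀ n, ∀ y, 0 < y → |W (R n) y| ≤ Real.exp (-(s * y)) := by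
    intro n y hy
    have hp : 0 < Real.sinh (s * R n) := Real.sinh_pos_iff.mpr (mul_pos hs (hRpos n))
    have hq : 0 < Real.sinh (s * y) := Real.sinh_pos_iff.mpr (mul_pos hs hy)
    rw [hW]
    split_ifs with h
    · have h0 : 0 ≤ Real.sinh (s * (R n - y)) :=
        Real.sinh_nonneg_iff.mpr (mul_nonneg hs.le (sub_nonneg.mpr h))
      rw [abs_of_nonneg (div_nonneg h0 hp.le), mode_formula s _ y hs (hRpos n)]
      have : 0 ≤ Real.exp (-(s * R n)) * Real.sinh (s * y) * (Real.sinh (s * R n))⁻¹ := by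
        positivity
      linarith
    · simpa using (Real.exp_pos _).le
  have hsR : Tendsto (fun n => s * R n) atTop atTop := hR.const_mul_atTop hs
  have hsinh : Tendsto (fun n => Real.sinh (s * R n)) atTop atTop := by
    refine tendsto_atTop_mono (fun n => ?_) hsR
    exact Real.self_le_sinh_iff.mpr (mul_pos hs (hRpos n)).le
  have hWlim : ∀ y, Tendsto (fun n => W (R n) y) atTop (nhds (Real.exp (-(s * y)))) := by
    intro y
    have h1 : Tendsto (fun n => Real.exp (-(s * y)) -
        Real.exp (-(s * R n)) * Real.sinh (s * y) * (Real.sinh (s * R n))⁻¹) atTop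
        (nhds (Real.exp (-(s * y)) - 0 * Real.sinh (s * y) * 0)) :=
      tendsto_const_nhds.sub
        (((Real.tendsto_exp_neg_atTop_nhds_zero.comp hsR).mul_const _).mul
          (tendsto_inv_atTop_zero.comp hsinh))
    simp only [mul_zero, sub_zero] at h1
    refine h1.congr' ?_
    filter_upwards [hR.eventually_ge_atTop y] with n hn
    rw [hW, if_pos hn, mode_formula s _ y hs (hRpos n)]
  have hmeas : ∀ n, Measurable (fun y => W (R n) y) := by
    intro n
    simp only [hW]
    refine Measurable.ite measurableSet_Iic ?_ measurable_const
    fun_prop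
  have main := tendsto_integral_of_dominated_convergence (μ := volume.restrict (Set.Ioi (0:ℝ)))
    (F := fun n y => |α n * W (R n) y - a * Real.exp (-(s * y))| ^ 2) (f := fun _ => (0:ℝ))
    (fun y => (C + |a|) ^ 2 * Real.exp (-(2 * s) * y)) ?_ ?_ ?_ ?_
  · simpa using main
  · intro n
    have := hmeas n
    apply Measurable.aestronglyMeasurable
    have h2 : Measurable (fun y => α n * W (R n) y - a * Real.exp (-(s * y))) := by fun_prop
    simp only [sq_abs]
    exact h2.pow_const 2
  · exact (integrableOn_exp_mul_Ioi (by linarith) 0).const_mul _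
  · intro n
    filter_upwards [ae_restrict_mem measurableSet_Ioi] with y hy
    have hb : |α n * W (R n) y - a * Real.exp (-(s * y))| ≤ (C + |a|) * Real.exp (-(s * y)) := by
      refine (abs_sub _ _).trans ?_
      rw [abs_mul, abs_mul, abs_of_pos (Real.exp_pos _), add_mul]
      gcongr
      · exact hC' n
      · exact hWb n y hy
    rw [Real.norm_of_nonneg (by positivity)]
    calc _ ≤ ((C + |a|) * Real.exp (-(s * y))) ^ 2 := by gcongr
      _ = _ := by
        rw [mul_pow, ← Real.exp_nat_mul]
        congr 2
        push_cast
        ring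
  · refine Eventually.of_forall fun y => ?_
    have h := ((hα.mul (hWlim y)).sub_const (a * Real.exp (-(s * y)))).abs.pow 2
    simpa using h
end
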